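/- Let X be a real Banach space, 0<α<1, M>0, σ>0 with σ+α/2≠1, and let γ>2/(σ+α/2). Fix T>0 and let N≥1 be an integer, with the graded mesh t_i=(iτ)^γ, τ=T^{1/γ}/N, τ_n=t_n−t_{n−1}. Let u:(0,T]→X be three times continuously differentiable with ‖u‴(t)‖ ≤ M·t^{σ+α/2−3} for all t∈(0,T]. For s∈I_i=(t_{i−1},t_i] define e₁(s)=∫_s^{t_i}(q−s)u‴(q)dq − (1/(2τ_i))∫_{t_{i−1}}^{t_i}(q−t_{i−1})²u‴(q)dq, and for 1≤j≤N set η₁^j=∫_{t_{j−1}}^{t_j}(I^α e₁)(t)dt. Then there is a constant C>0, depending only on M, σ, α, γ and T, such that ‖η₁^j‖ ≤ C·τ_j·τ²·t_j^{3α/2+σ−1−2/γ} for all 1≤j≤N. -/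

import Mathlib

/-- Graded time mesh `t_i = (i τ)^γ` with `τ = T^(1/γ)/N`. -/
noncomputable def tmesh (T γ : ℝ) (N : ℕ) (i : ℕ) : ℝ :=
  ((i : ℝ) * (T ^ (1/γ) / (N : ℝ))) ^ γ

/-- Mesh step `τ_n = t_n - t_{n-1}`. -/
noncomputable def tstep (T γ : ℝ) (N n : ℕ) : ℝ :=
  tmesh T γ N n - tmesh T γ N (n - 1)

/-- Kernel `ω_β(t) = t^(β-1)/Γ(β)`. -/
noncomputable def omegaK (β t : ℝ) : ℝ := t ^ (β - 1) / Real.Gamma β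

/-- Riemann–Liouville fractional integral `(I^α v)(t) = ∫₀^t ω_α(t-s) v(s) ds`. -/
noncomputable def Ifrac {X : Type*} [NormedAddCommGroup X] [NormedSpace ℝ X]
    (α : ℝ) (v : ℝ → X) (t : ℝ) : X :=
  ∫ s in (0:ℝ)..t, omegaK α (t - s) • v s

open MeasureTheory

theorem intervalIntegrable_one_sub_rpow_mul_rpow {a l : ℝ} (ha : 0 < a) (hl : 0 < l) :
    IntervalIntegrable (fun x : ℝ => (1 - x) ^ (a - 1) * x ^ (l - 1)) volume 0 1 := by
  have h := (Complex.betaIntegral_convergent (u := (l : ℂ)) (v := (a : ℂ))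
    (by simpa using hl) (by simpa using ha)).norm
  refine h.congr ?_
  intro x hx
  rw [Set.uIoc_of_le zero_le_one] at hx
  have e1 : ((x : ℂ) ^ ((l : ℂ) - 1)) = ((x ^ (l - 1) : ℝ) : ℂ) := by
    rw [Complex.ofReal_cpow hx.1.le]; push_cast; rfl
  have e2 : ((1 - (x : ℂ)) ^ ((a : ℂ) - 1)) = (((1 - x) ^ (a - 1) : ℝ) : ℂ) := by
    rw [Complex.ofReal_cpow (by linarith [hx.2])]; push_cast; rfl
  have p1 : 0 ≤ x ^ (l - 1) := Real.rpow_nonneg hx.1.le _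
  have p2 : 0 ≤ (1 - x) ^ (a - 1) := Real.rpow_nonneg (by linarith [hx.2]) _
  simp only [e1, e2, norm_mul, Complex.norm_real, Real.norm_of_nonneg p1, Real.norm_of_nonneg p2]
  ring

theorem exists_integral_sub_rpow_mul_rpow {a l : ℝ} (ha : 0 < a) (hl : 0 < l) :
    ∃ B : ℝ, 0 ≤ B ∧ ∀ t : ℝ, 0 < t →
      IntervalIntegrable (fun s : ℝ => (t - s) ^ (a - 1) * s ^ (l - 1)) volume 0 t ∧
      ∫ s in (0 : ℝ)..t, (t - s) ^ (a - 1) * s ^ (l - 1) = B * t ^ (a + l - 1) := by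
  have hI := intervalIntegrable_one_sub_rpow_mul_rpow ha hl
  refine ⟨∫ x in (0 : ℝ)..1, (1 - x) ^ (a - 1) * x ^ (l - 1), ?_, fun t ht => ?_⟩
  · refine intervalIntegral.integral_nonneg zero_le_one fun x hx => ?_
    exact mul_nonneg (Real.rpow_nonneg (by linarith [hx.2]) _) (Real.rpow_nonneg hx.1 _)
  have key : Set.EqOn
      (fun s => t ^ (a + l - 2) * ((1 - t⁻¹ * s) ^ (a - 1) * (t⁻¹ * s) ^ (l - 1)))
      (fun s => (t - s) ^ (a - 1) * s ^ (l - 1)) (Set.uIoc 0 t) := by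
    intro s hs
    rw [Set.uIoc_of_le ht.le] at hs
    have h1 : t - s = t * (1 - t⁻¹ * s) := by field_simp
    have h2 : s = t * (t⁻¹ * s) := by field_simp
    have h3 : 0 ≤ 1 - t⁻¹ * s := by
      have : t⁻¹ * s ≤ 1 := by
        rw [inv_mul_le_iff₀ ht]; linarith [hs.2]
      linarith
    have h4 : 0 ≤ t⁻¹ * s := mul_nonneg (inv_nonneg.2 ht.le) hs.1.le
    have e1 : (t - s) ^ (a - 1) = t ^ (a - 1) * (1 - t⁻¹ * s) ^ (a - 1) := by
      rw [h1, Real.mul_rpow ht.le h3]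
    have e2 : s ^ (l - 1) = t ^ (l - 1) * (t⁻¹ * s) ^ (l - 1) := by
      rw [← Real.mul_rpow ht.le h4, ← h2]
    have e3 : t ^ (a + l - 2) = t ^ (a - 1) * t ^ (l - 1) := by
      rw [← Real.rpow_add ht]; ring_nf
    simp only [e1, e2, e3]
    ring
  constructor
  · have h := hI.comp_mul_left (c := t⁻¹)
    simp only [zero_div, one_div, inv_inv] at h
    exact (h.const_mul (t ^ (a + l - 2))).congr key
  · rw [intervalIntegral.integral_of_le ht.le, ← Set.uIoc_of_le ht.le,
      ← setIntegral_congr_fun measurableSet_uIoc key, Set.uIoc_of_le ht.le,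
      ← intervalIntegral.integral_of_le ht.le, intervalIntegral.integral_const_mul,
      intervalIntegral.integral_comp_mul_left
        (fun x => (1 - x) ^ (a - 1) * x ^ (l - 1)) (inv_ne_zero ht.ne')]
    simp only [inv_inv, mul_zero, inv_mul_cancel₀ ht.ne', smul_eq_mul]
    have e : t ^ (a + l - 1) = t ^ (a + l - 2) * t := by
      rw [← Real.rpow_add_one ht.ne']; ring_nf
    rw [e]
    ring

theorem integral_rpow_le_mul_sub {p : ℝ} (hp : -1 < p) {a b : ℝ} (ha : 0 ≤ a) (hab : a < b) :
    ∫ t in a..b, t ^ p ≤ (1 + (p + 1)⁻¹) * ((b - a) * b ^ p) := by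
  have hb : 0 < b := ha.trans_lt hab
  have hbp : 0 ≤ (b - a) * b ^ p := mul_nonneg (by linarith) (Real.rpow_nonneg hb.le _)
  have hp1 : 0 < (p + 1)⁻¹ := inv_pos.2 (by linarith)
  rcases le_or_gt 0 p with h | h
  · have : ∫ t in a..b, t ^ p ≤ ∫ _t in a..b, b ^ p :=
      intervalIntegral.integral_mono_on hab.le (intervalIntegral.intervalIntegrable_rpow' hp)
        (by simp) fun x hx => Real.rpow_le_rpow (ha.trans hx.1) hx.2 h
    rw [intervalIntegral.integral_const, smul_eq_mul] at this
    nlinarith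
  · rw [integral_rpow (Or.inl hp)]
    have h1 : b ^ (p + 1) = b * b ^ p := by rw [Real.rpow_add_one hb.ne', mul_comm]
    have h2 : a * b ^ p ≤ a ^ (p + 1) := by
      rcases ha.eq_or_lt with h0 | h0
      · rw [← h0, zero_mul]; exact Real.rpow_nonneg le_rfl _
      · rw [Real.rpow_add_one h0.ne', mul_comm]
        exact mul_le_mul_of_nonneg_right (Real.rpow_le_rpow_of_nonpos h0 hab.le h.le) ha
    have : (b ^ (p + 1) - a ^ (p + 1)) * (p + 1)⁻¹ ≤ ((b - a) * b ^ p) * (p + 1)⁻¹ :=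
      mul_le_mul_of_nonneg_right (by rw [h1]; linarith) hp1.le
    rw [div_eq_mul_inv]
    nlinarith

theorem rpow_sub_rpow_le {g x y : ℝ} (hg : 1 ≤ g) (hx : 0 < x) (hy : 0 ≤ y) :
    x ^ g - y ^ g ≤ g * x ^ (g - 1) * (x - y) := by
  have hb := one_add_mul_self_le_rpow_one_add (s := y / x - 1)
    (by linarith [div_nonneg hy hx.le]) hg
  rw [show 1 + (y / x - 1) = y / x by ring, Real.div_rpow hy hx.le,
    le_div_iff₀ (Real.rpow_pos_of_pos hx _)] at hb
  have e : x ^ g = x ^ (g - 1) * x := by rw [← Real.rpow_add_one hx.ne']; ring_nf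
  have e2 : (1 + g * (y / x - 1)) * (x ^ (g - 1) * x) =
    x ^ (g - 1) * x - g * x ^ (g - 1) * (x - y) := by field_simp; ring
  rw [e, e2] at hb
  rw [e]; linarith

/-- The local remainder of a function with third derivative `w` on the interval `(a, b]`. -/
noncomputable def localRemainder {X : Type*} [NormedAddCommGroup X] [NormedSpace ℝ X]
    (w : ℝ → X) (a b s : ℝ) : X :=
  (∫ q in s..b, (q - s) • w q) - (2 * (b - a))⁻¹ • ∫ q in a..b, ((q - a) ^ 2) • w q

section

variable {X : Type*} [NormedAddCommGroup X] [NormedSpace ℝ X]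

theorem norm_localRemainder_le_of_bound {w : ℝ → X} {a b s K : ℝ}
    (hs : s ∈ Set.Ioc a b) (hw : ∀ q ∈ Set.Ioc a b, ‖w q‖ ≤ K) :
    ‖localRemainder w a b s‖ ≤ 2 * K * (b - a) ^ 2 := by
  have hab : a < b := hs.1.trans_le hs.2
  have hd : 0 < b - a := sub_pos.2 hab
  have hK : 0 ≤ K := (norm_nonneg _).trans (hw s hs)
  have h1 : ‖∫ q in s..b, (q - s) • w q‖ ≤ (b - a) * K * |b - s| := by
    refine intervalIntegral.norm_integral_le_of_norm_le_const fun q hq => ?_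
    rw [Set.uIoc_of_le hs.2] at hq
    rw [norm_smul, Real.norm_of_nonneg (by linarith [hq.1])]
    exact mul_le_mul (by linarith [hq.2, hs.1]) (hw q ⟨hs.1.trans hq.1, hq.2⟩)
      (norm_nonneg _) hd.le
  have h2 : ‖∫ q in a..b, ((q - a) ^ 2) • w q‖ ≤ (b - a) ^ 2 * K * |b - a| := by
    refine intervalIntegral.norm_integral_le_of_norm_le_const fun q hq => ?_
    rw [Set.uIoc_of_le hab.le] at hq
    rw [norm_smul, Real.norm_of_nonneg (by positivity)]
    exact mul_le_mul (by nlinarith [hq.1, hq.2]) (hw q hq) (norm_nonneg _) (by positivity)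
  rw [abs_of_nonneg (by linarith [hs.2])] at h1
  rw [abs_of_pos hd] at h2
  have h3 : ‖(2 * (b - a))⁻¹ • ∫ q in a..b, ((q - a) ^ 2) • w q‖ ≤ (b - a) ^ 2 * K := by
    rw [norm_smul, Real.norm_of_nonneg (by positivity), inv_mul_le_iff₀ (by positivity)]
    have : 0 ≤ (b - a) ^ 2 * K * (b - a) := by positivity
    linarith
  have h4 : (b - a) * K * (b - s) ≤ (b - a) * K * (b - a) :=
    mul_le_mul_of_nonneg_left (by linarith [hs.1]) (by positivity)
  refine (norm_sub_le _ _).trans ?_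
  linarith

theorem norm_localRemainder_zero_le {w : ℝ → X} {b s M c : ℝ} (hc : 0 < c) (hc1 : c ≠ 1)
    (hM : 0 ≤ M) (hs : s ∈ Set.Ioc 0 b) (hw : ∀ q ∈ Set.Ioc 0 b, ‖w q‖ ≤ M * q ^ (c - 3)) :
    ‖localRemainder w 0 b s‖ ≤
      M * (|c - 1|⁻¹ + c⁻¹) * (b ^ (c - 1) + s ^ (c - 1)) := by
  have hb : 0 < b := hs.1.trans_le hs.2
  have hbp : 0 ≤ b ^ (c - 1) := Real.rpow_nonneg hb.le _
  have hsp : 0 ≤ s ^ (c - 1) := Real.rpow_nonneg hs.1.le _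
  have h0 : (0 : ℝ) ∉ Set.uIcc s b := by
    rw [Set.uIcc_of_le hs.2]; exact fun h => absurd h.1 (not_le.2 hs.1)
  have h1 : ‖∫ q in s..b, (q - s) • w q‖ ≤ ∫ q in s..b, M * q ^ (c - 2) := by
    refine intervalIntegral.norm_integral_le_of_norm_le hs.2 (Filter.Eventually.of_forall ?_)
      ((intervalIntegral.intervalIntegrable_rpow (Or.inr h0)).const_mul _)
    intro q hq
    have hq0 : 0 < q := hs.1.trans hq.1
    rw [norm_smul, Real.norm_of_nonneg (by linarith [hq.1])]
    have e : M * q ^ (c - 2) = q * (M * q ^ (c - 3)) := by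
      rw [show c - 2 = (c - 3) + 1 by ring, Real.rpow_add_one hq0.ne']; ring
    rw [e]
    exact mul_le_mul (by linarith [hs.1]) (hw q ⟨hq0, hq.2⟩) (norm_nonneg _) hq0.le
  have h2 : ‖∫ q in 0..b, ((q - 0) ^ 2) • w q‖ ≤ ∫ q in 0..b, M * q ^ (c - 1) := by
    refine intervalIntegral.norm_integral_le_of_norm_le hb.le (Filter.Eventually.of_forall ?_)
      ((intervalIntegral.intervalIntegrable_rpow' (by linarith)).const_mul _)
    intro q hq
    rw [norm_smul, Real.norm_of_nonneg (by positivity), sub_zero]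
    have e : M * q ^ (c - 1) = q ^ 2 * (M * q ^ (c - 3)) := by
      rw [show c - 1 = (c - 3) + (2 : ℕ) by push_cast; ring, Real.rpow_add_natCast hq.1.ne']; ring
    rw [e]
    exact mul_le_mul_of_nonneg_left (hw q hq) (by positivity)
  rw [intervalIntegral.integral_const_mul, integral_rpow (Or.inr ⟨fun h => hc1 (by linarith), h0⟩),
    show c - 2 + 1 = c - 1 by ring] at h1
  rw [intervalIntegral.integral_const_mul, integral_rpow (Or.inl (by linarith)),
    show c - 1 + 1 = c by ring, Real.zero_rpow hc.ne', sub_zero] at h2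
  have h3 : (b ^ (c - 1) - s ^ (c - 1)) / (c - 1) ≤
      |c - 1|⁻¹ * (b ^ (c - 1) + s ^ (c - 1)) := by
    refine (le_abs_self _).trans ?_
    rw [abs_div, div_eq_inv_mul]
    refine mul_le_mul_of_nonneg_left ?_ (by positivity)
    rw [abs_le]; constructor <;> linarith
  have h4 : ‖(2 * (b - 0))⁻¹ • ∫ q in 0..b, ((q - 0) ^ 2) • w q‖ ≤ M * (c⁻¹ * b ^ (c - 1)) := by
    rw [norm_smul, Real.norm_of_nonneg (by simpa using hb.le), sub_zero,
      inv_mul_le_iff₀ (by positivity)]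
    have e : b ^ c = b ^ (c - 1) * b := by rw [← Real.rpow_add_one hb.ne']; ring_nf
    rw [e] at h2
    refine h2.trans ?_
    have : 0 ≤ b * (M * (c⁻¹ * b ^ (c - 1))) := by positivity
    rw [div_eq_mul_inv]
    linarith
  refine (norm_sub_le _ _).trans ?_
  have h5 := mul_le_mul_of_nonneg_left h3 hM
  have h6 : 0 ≤ M * (c⁻¹ * s ^ (c - 1)) := by positivity
  linarith

end

section

variable {T g : ℝ} {N : ℕ}

theorem tmesh_zero (hg : 1 ≤ g) : tmesh T g N 0 = 0 := by
  simp [tmesh, Real.zero_rpow (by linarith : g ≠ 0)]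

theorem meshParam_pos (hT : 0 < T) (hN : 1 ≤ N) : 0 < T ^ (1 / g) / (N : ℝ) :=
  div_pos (Real.rpow_pos_of_pos hT _) (by exact_mod_cast hN)

theorem tmesh_strictMono (hg : 1 ≤ g) (hT : 0 < T) (hN : 1 ≤ N) : StrictMono (tmesh T g N) := by
  intro i j hij
  have h := meshParam_pos (g := g) hT hN
  refine Real.rpow_lt_rpow (by positivity) ?_ (by linarith)
  exact mul_lt_mul_of_pos_right (by exact_mod_cast hij) h

theorem tmesh_self (hg : 1 ≤ g) (hT : 0 < T) (hN : 1 ≤ N) : tmesh T g N N = T := by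
  have hN' : (N : ℝ) ≠ 0 := by exact_mod_cast (by omega : N ≠ 0)
  rw [tmesh, mul_div_cancel₀ _ hN', ← Real.rpow_mul hT.le, one_div,
    inv_mul_cancel₀ (by linarith), Real.rpow_one]

theorem tmesh_nonneg (hg : 1 ≤ g) (hT : 0 < T) (hN : 1 ≤ N) (i : ℕ) : 0 ≤ tmesh T g N i := by
  rw [← tmesh_zero (T := T) (N := N) hg]
  exact (tmesh_strictMono hg hT hN).monotone (Nat.zero_le i)

theorem tmesh_pos (hg : 1 ≤ g) (hT : 0 < T) (hN : 1 ≤ N) {i : ℕ} (hi : 1 ≤ i) :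
    0 < tmesh T g N i := by
  rw [← tmesh_zero (T := T) (N := N) hg]
  exact tmesh_strictMono hg hT hN hi

theorem tmesh_pred_ge (hg : 1 ≤ g) (hT : 0 < T) (hN : 1 ≤ N) {i : ℕ} (hi : 2 ≤ i) :
    (2⁻¹ : ℝ) ^ g * tmesh T g N i ≤ tmesh T g N (i - 1) := by
  have h := meshParam_pos (g := g) hT hN
  rw [tmesh, tmesh, ← Real.mul_rpow (by norm_num) (by positivity)]
  refine Real.rpow_le_rpow (by positivity) ?_ (by linarith)
  rw [Nat.cast_sub (by omega), ← mul_assoc]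
  have hi' : (2 : ℝ) ≤ i := by exact_mod_cast hi
  exact mul_le_mul_of_nonneg_right (by push_cast; linarith) h.le

theorem sq_tstep_le (hg : 1 ≤ g) (hT : 0 < T) (hN : 1 ≤ N) {i : ℕ} (hi : 1 ≤ i) :
    (tmesh T g N i - tmesh T g N (i - 1)) ^ 2 ≤
      g ^ 2 * (T ^ (1 / g) / (N : ℝ)) ^ 2 * tmesh T g N i ^ (2 - 2 / g) := by
  have h := meshParam_pos (g := g) hT hN
  have hmono := (tmesh_strictMono hg hT hN).monotone (Nat.sub_le i 1)
  unfold tmesh at *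
  set r := T ^ (1 / g) / (N : ℝ)
  have hi' : (0 : ℝ) < i := by exact_mod_cast hi
  have hg0 : g ≠ 0 := by linarith
  have hb := rpow_sub_rpow_le hg (mul_pos hi' h)
    (mul_nonneg (Nat.cast_nonneg (i - 1)) h.le)
  rw [Nat.cast_sub hi] at hb hmono ⊢
  have e1 : (i : ℝ) * r - ((i : ℝ) - (1 : ℕ)) * r = r := by push_cast; ring
  rw [e1] at hb
  have e2 : (((i : ℝ) * r) ^ g) ^ (2 - 2 / g) = (((i : ℝ) * r) ^ (g - 1)) ^ 2 := by
    rw [← Real.rpow_mul (by positivity), ← Real.rpow_mul_natCast (by positivity)]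
    congr 1
    field_simp
    push_cast
    ring
  rw [e2]
  refine (pow_le_pow_left₀ (by linarith) hb 2).trans (le_of_eq ?_)
  ring

theorem sq_meshParam_eq (hg : 1 ≤ g) (hT : 0 < T) (hN : 1 ≤ N) :
    (T ^ (1 / g) / (N : ℝ)) ^ 2 = tmesh T g N 1 ^ (2 / g) := by
  have h := meshParam_pos (g := g) hT hN
  have hg0 : g ≠ 0 := by linarith
  rw [tmesh, Nat.cast_one, one_mul, ← Real.rpow_mul h.le, mul_div_cancel₀ _ hg0]
  norm_cast

end

theorem norm_localRemainder_tmesh_le {X : Type*} [NormedAddCommGroup X] [NormedSpace ℝ X]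
    {T g c l M : ℝ} {N i : ℕ} {w : ℝ → X} (hg : 1 ≤ g) (hT : 0 < T) (hN : 1 ≤ N)
    (hc : 0 < c) (hc1 : c ≠ 1) (hl : l ≤ 1) (hlc : l ≤ c - 2 / g) (hM : 0 ≤ M)
    (hw : ∀ t ∈ Set.Ioc (0 : ℝ) T, ‖w t‖ ≤ M * t ^ (c - 3)) (hi : 1 ≤ i) (hiN : i ≤ N)
    {s : ℝ} (hs : s ∈ Set.Ioc (tmesh T g N (i - 1)) (tmesh T g N i)) :
    ‖localRemainder w (tmesh T g N (i - 1)) (tmesh T g N i) s‖ ≤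
      (2 * M * (|c - 1|⁻¹ + c⁻¹) + 2 * (M * (1 + ((2⁻¹ : ℝ) ^ g) ^ (c - 3))) * g ^ 2) *
        (T ^ (1 / g) / (N : ℝ)) ^ 2 * tmesh T g N i ^ (c - 2 / g - l) * s ^ (l - 1) := by
  have hr := meshParam_pos (g := g) hT hN
  have hb := tmesh_pos (T := T) (N := N) hg hT hN hi
  have hbT : tmesh T g N i ≤ T := by
    have := (tmesh_strictMono hg hT hN).monotone hiN
    rwa [tmesh_self hg hT hN] at this
  have ha := tmesh_nonneg (T := T) (N := N) hg hT hN (i - 1)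
  have hs0 : 0 < s := ha.trans_lt hs.1
  have hg0 : 0 < g := by linarith
  have hsb : tmesh T g N i ^ (l - 1) ≤ s ^ (l - 1) :=
    Real.rpow_le_rpow_of_nonpos hs0 hs.2 (by linarith)
  have hsp : 0 < s ^ (l - 1) := Real.rpow_pos_of_pos hs0 _
  have hbp : 0 < tmesh T g N i ^ (c - 2 / g - l) := Real.rpow_pos_of_pos hb _
  set Q := (T ^ (1 / g) / (N : ℝ)) ^ 2 * tmesh T g N i ^ (c - 2 / g - l) * s ^ (l - 1) with hQ
  have hQ0 : 0 ≤ Q := by positivity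
  suffices H : ‖localRemainder w (tmesh T g N (i - 1)) (tmesh T g N i) s‖ ≤
      2 * M * (|c - 1|⁻¹ + c⁻¹) * Q ∨
      ‖localRemainder w (tmesh T g N (i - 1)) (tmesh T g N i) s‖ ≤
      2 * (M * (1 + ((2⁻¹ : ℝ) ^ g) ^ (c - 3))) * g ^ 2 * Q by
    have p1 : 0 ≤ 2 * M * (|c - 1|⁻¹ + c⁻¹) * Q := by positivity
    have p2 : 0 ≤ 2 * (M * (1 + ((2⁻¹ : ℝ) ^ g) ^ (c - 3))) * g ^ 2 * Q := by positivity
    refine le_of_le_of_eq (b := 2 * M * (|c - 1|⁻¹ + c⁻¹) * Q +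
      2 * (M * (1 + ((2⁻¹ : ℝ) ^ g) ^ (c - 3))) * g ^ 2 * Q) ?_ (by rw [hQ]; ring)
    rcases H with H | H <;> linarith
  rcases Nat.eq_or_lt_of_le hi with h1 | h2
  · left
    subst h1
    rw [Nat.sub_self, tmesh_zero hg] at hs ⊢
    refine (norm_localRemainder_zero_le hc hc1 hM hs fun q hq =>
      hw q ⟨hq.1, hq.2.trans hbT⟩).trans ?_
    rw [sq_meshParam_eq hg hT hN, ← Real.rpow_add hb] at hQ
    have e : 2 / g + (c - 2 / g - l) = c - l := by ring
    rw [e] at hQ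
    have hcl : 0 ≤ c - l := by linarith [div_pos two_pos hg0]
    have q1 : tmesh T g N 1 ^ (c - 1) ≤ Q := by
      rw [hQ, show c - 1 = (c - l) + (l - 1) by ring, Real.rpow_add hb]
      exact mul_le_mul_of_nonneg_left hsb (Real.rpow_nonneg hb.le _)
    have q2 : s ^ (c - 1) ≤ Q := by
      rw [hQ, show c - 1 = (c - l) + (l - 1) by ring, Real.rpow_add hs0]
      exact mul_le_mul_of_nonneg_right (Real.rpow_le_rpow hs0.le hs.2 hcl) hsp.le
    have : M * (|c - 1|⁻¹ + c⁻¹) * (tmesh T g N 1 ^ (c - 1) + s ^ (c - 1)) ≤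
        M * (|c - 1|⁻¹ + c⁻¹) * (Q + Q) :=
      mul_le_mul_of_nonneg_left (by linarith) (by positivity)
    linarith
  · right
    have hd : 0 < (2⁻¹ : ℝ) ^ g := by positivity
    have hdb := tmesh_pred_ge (T := T) (N := N) hg hT hN h2
    have hsq := sq_tstep_le (T := T) (N := N) hg hT hN hi
    set b := tmesh T g N i
    set a := tmesh T g N (i - 1)
    have hb3 : 0 < b ^ (c - 3) := Real.rpow_pos_of_pos hb _
    have hd3 : 0 < ((2⁻¹ : ℝ) ^ g) ^ (c - 3) := Real.rpow_pos_of_pos hd _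
    refine (norm_localRemainder_le_of_bound
      (K := M * ((1 + ((2⁻¹ : ℝ) ^ g) ^ (c - 3)) * b ^ (c - 3))) hs fun q hq => ?_).trans ?_
    · have hq0 := ha.trans_lt hq.1
      refine (hw q ⟨hq0, hq.2.trans hbT⟩).trans (mul_le_mul_of_nonneg_left ?_ hM)
      rcases le_or_gt 0 (c - 3) with h | h
      · have := Real.rpow_le_rpow hq0.le hq.2 h
        nlinarith
      · have := Real.rpow_le_rpow_of_nonpos (by positivity) (hdb.trans hq.1.le) h.le
        rw [Real.mul_rpow hd.le hb.le] at this
        nlinarith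
    · have hbl : b ^ (c - 3) * b ^ (2 - 2 / g) ≤ b ^ (c - 2 / g - l) * s ^ (l - 1) := by
        rw [← Real.rpow_add hb, show c - 3 + (2 - 2 / g) = (c - 2 / g - l) + (l - 1) by ring,
          Real.rpow_add hb]
        exact mul_le_mul_of_nonneg_left hsb hbp.le
      have m1 := mul_le_mul_of_nonneg_left hsq
        (by positivity : 0 ≤ 2 * (M * ((1 + ((2⁻¹ : ℝ) ^ g) ^ (c - 3)) * b ^ (c - 3))))
      have m2 := mul_le_mul_of_nonneg_left hbl
        (by positivity : 0 ≤ 2 * (M * (1 + ((2⁻¹ : ℝ) ^ g) ^ (c - 3))) * g ^ 2 *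
          (T ^ (1 / g) / (N : ℝ)) ^ 2)
      rw [hQ]
      linarith

theorem exists_norm_integral_Ifrac_le {X : Type*} [NormedAddCommGroup X] [NormedSpace ℝ X]
    {α l : ℝ} (hα : 0 < α) (hl : 0 < l) :
    ∃ D : ℝ, 0 ≤ D ∧ ∀ (v : ℝ → X) (a b K : ℝ), 0 ≤ a → a < b → 0 ≤ K →
      (∀ s ∈ Set.Ioc 0 b, ‖v s‖ ≤ K * s ^ (l - 1)) →
      ‖∫ t in a..b, Ifrac α v t‖ ≤ D * K * ((b - a) * b ^ (α + l - 1)) := by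
  obtain ⟨B, hB0, hB⟩ := exists_integral_sub_rpow_mul_rpow hα hl
  have hΓ := Real.Gamma_pos_of_pos hα
  have hp : -1 < α + l - 1 := by linarith
  have hp' : 0 < (α + l - 1 + 1)⁻¹ := inv_pos.2 (by linarith)
  refine ⟨B / Real.Gamma α * (1 + (α + l - 1 + 1)⁻¹), by positivity,
    fun v a b K ha hab hK hv => ?_⟩
  have hI : ∀ t ∈ Set.Ioc a b, ‖Ifrac α v t‖ ≤ K / Real.Gamma α * B * t ^ (α + l - 1) := by
    intro t ht
    have ht0 := ha.trans_lt ht.1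
    obtain ⟨h1, h2⟩ := hB t ht0
    rw [mul_assoc, ← h2, ← intervalIntegral.integral_const_mul]
    refine intervalIntegral.norm_integral_le_of_norm_le ht0.le (Filter.Eventually.of_forall ?_)
      (h1.const_mul _)
    intro s hs
    have hk : 0 ≤ (t - s) ^ (α - 1) := Real.rpow_nonneg (by linarith [hs.2]) _
    rw [norm_smul, omegaK, Real.norm_of_nonneg (by positivity)]
    refine (mul_le_mul_of_nonneg_left (hv s ⟨hs.1, hs.2.trans ht.2⟩)
      (by positivity)).trans (le_of_eq ?_)
    ring
  refine (intervalIntegral.norm_integral_le_of_norm_le hab.le (Filter.Eventually.of_forall hI)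
    ((intervalIntegral.intervalIntegrable_rpow' hp).const_mul _)).trans ?_
  rw [intervalIntegral.integral_const_mul]
  refine (mul_le_mul_of_nonneg_left (integral_rpow_le_mul_sub hp ha hab)
    (by positivity)).trans (le_of_eq ?_)
  ring

theorem stmt9 {X : Type*} [NormedAddCommGroup X] [NormedSpace ℝ X] [CompleteSpace X]
    (α M σ γ T : ℝ) (hα0 : 0 < α) (hα1 : α < 1) (hM : 0 < M) (hσ : 0 < σ)
    (hσα : σ + α/2 ≠ 1) (hγ1 : 1 ≤ γ) (hγ : 2 / (σ + α/2) < γ) (hT : 0 < T) :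
    ∃ C > 0, ∀ N : ℕ, 1 ≤ N →
      ∀ u u' u'' u''' : ℝ → X,
      (∀ s ∈ Set.Ioc (0:ℝ) T, HasDerivWithinAt u (u' s) (Set.Ioc (0:ℝ) T) s) →
      (∀ s ∈ Set.Ioc (0:ℝ) T, HasDerivWithinAt u' (u'' s) (Set.Ioc (0:ℝ) T) s) →
      (∀ s ∈ Set.Ioc (0:ℝ) T, HasDerivWithinAt u'' (u''' s) (Set.Ioc (0:ℝ) T) s) →
      ContinuousOn u''' (Set.Ioc (0:ℝ) T) →
      (∀ t ∈ Set.Ioc (0:ℝ) T, ‖u''' t‖ ≤ M * t ^ (σ + α/2 - 3)) →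
      ∀ e1 : ℝ → X,
      (∀ i : ℕ, 1 ≤ i → i ≤ N →
        ∀ s ∈ Set.Ioc (tmesh T γ N (i - 1)) (tmesh T γ N i),
          e1 s = (∫ q in s..tmesh T γ N i, (q - s) • u''' q)
            - (2 * tstep T γ N i)⁻¹ • ∫ q in tmesh T γ N (i - 1)..tmesh T γ N i,
                ((q - tmesh T γ N (i - 1)) ^ 2) • u''' q) →
      ∀ j : ℕ, 1 ≤ j → j ≤ N →
        ‖∫ t in tmesh T γ N (j - 1)..tmesh T γ N j, Ifrac α e1 t‖ ≤
          C * tstep T γ N j * (T ^ (1/γ) / (N : ℝ)) ^ 2 *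
            (tmesh T γ N j) ^ (3*α/2 + σ - 1 - 2/γ) := by
  have hγ0 : 0 < γ := by linarith
  have hc : 0 < σ + α / 2 := by linarith
  have hκ : 0 < σ + α / 2 - 2 / γ := by
    rw [div_lt_iff₀ hc] at hγ
    rw [sub_pos, div_lt_iff₀ hγ0]
    linarith
  obtain ⟨l, hl0, hl1, hlκ⟩ : ∃ l : ℝ, 0 < l ∧ l ≤ 1 ∧ l ≤ σ + α / 2 - 2 / γ :=
    ⟨min 1 (σ + α / 2 - 2 / γ), lt_min one_pos hκ, min_le_left _ _, min_le_right _ _⟩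
  obtain ⟨D, hD0, hD⟩ := exists_norm_integral_Ifrac_le (X := X) hα0 hl0
  set A := 2 * M * (|σ + α / 2 - 1|⁻¹ + (σ + α / 2)⁻¹) +
    2 * (M * (1 + ((2⁻¹ : ℝ) ^ γ) ^ (σ + α / 2 - 3))) * γ ^ 2 with hA
  have hA0 : 0 ≤ A := by positivity
  refine ⟨D * A + 1, by positivity, ?_⟩
  intro N hN _ _ _ w _ _ _ _ hw e1 he1 j hj hjN
  have hr := meshParam_pos (g := γ) hT hN
  have hmono := tmesh_strictMono (T := T) (N := N) hγ1 hT hN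
  have hb := tmesh_pos (T := T) (N := N) hγ1 hT hN hj
  have hlt : tmesh T γ N (j - 1) < tmesh T γ N j := hmono (by omega)
  have hbp : 0 < tmesh T γ N j ^ (σ + α / 2 - 2 / γ - l) := Real.rpow_pos_of_pos hb _
  have hbound : ∀ s ∈ Set.Ioc 0 (tmesh T γ N j), ‖e1 s‖ ≤
      A * (T ^ (1 / γ) / (N : ℝ)) ^ 2 * tmesh T γ N j ^ (σ + α / 2 - 2 / γ - l) *
        s ^ (l - 1) := by
    intro s hs
    have hex : ∃ i, s ≤ tmesh T γ N i := ⟨j, hs.2⟩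
    classical
    obtain ⟨i, hi, hmin⟩ : ∃ i, s ≤ tmesh T γ N i ∧ ∀ k < i, ¬ s ≤ tmesh T γ N k :=
      ⟨Nat.find hex, Nat.find_spec hex, fun k hk => Nat.find_min hex hk⟩
    have hi1 : 1 ≤ i := by
      rcases Nat.eq_zero_or_pos i with h | h
      · rw [h, tmesh_zero hγ1] at hi
        exact absurd hs.1 (not_lt.2 hi)
      · exact h
    have hij : i ≤ j := not_lt.1 fun h => hmin j h hs.2
    have hsi : s ∈ Set.Ioc (tmesh T γ N (i - 1)) (tmesh T γ N i) :=
      ⟨not_le.1 (hmin (i - 1) (by omega)), hi⟩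
    have h := norm_localRemainder_tmesh_le hγ1 hT hN hc hσα hl1 hlκ hM.le hw hi1
      (hij.trans hjN) hsi
    rw [he1 i hi1 (hij.trans hjN) s hsi]
    refine h.trans (mul_le_mul_of_nonneg_right (mul_le_mul_of_nonneg_left ?_ (by positivity))
      (Real.rpow_nonneg hs.1.le _))
    exact Real.rpow_le_rpow (tmesh_nonneg hγ1 hT hN i) (hmono.monotone hij) (by linarith)
  refine (hD e1 _ _ _ (tmesh_nonneg hγ1 hT hN (j - 1)) hlt (by positivity) hbound).trans ?_
  have e : tmesh T γ N j ^ (3 * α / 2 + σ - 1 - 2 / γ) =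
      tmesh T γ N j ^ (σ + α / 2 - 2 / γ - l) * tmesh T γ N j ^ (α + l - 1) := by
    rw [← Real.rpow_add hb]
    ring_nf
  have hp : 0 < tmesh T γ N j ^ (α + l - 1) := Real.rpow_pos_of_pos hb _
  have hd : 0 < tstep T γ N j := sub_pos.2 hlt
  rw [e, show tmesh T γ N j - tmesh T γ N (j - 1) = tstep T γ N j from rfl]
  have hpos : 0 ≤ tstep T γ N j * (T ^ (1 / γ) / (N : ℝ)) ^ 2 *
      (tmesh T γ N j ^ (σ + α / 2 - 2 / γ - l) * tmesh T γ N j ^ (α + l - 1)) := by positivity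
  linarith
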